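/- Assume the continuum hypothesis (𝔠 = ℵ₁). Then for any two free (non-principal) ultrafilters 𝒰₁ and 𝒰₂ on ℕ, the ultrapower fields ℝ^ℕ/𝒰₁ and ℝ^ℕ/𝒰₂ are isomorphic as ordered fields. -/

import Mathlib

open FirstOrder Filter Cardinal

namespace FirstOrder.Language

universe u v w

variable {L : Language.{u, v}} {M N : Type w} [L.Structure M] [L.Structure N]

variable (L M) in
/-- A structure is countably saturated if every finitely satisfiable sequence of formulas in one
variable, with parameters from the structure, is satisfiable. -/
def IsCountablySaturated : Prop :=
  ∀ ⦃α : Type w⦄ (p : α → M) (φ : ℕ → L.Formula (α ⊕ Unit)),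
    (∀ k, ∃ x, ∀ i < k, (φ i).Realize (Sum.elim p fun _ => x)) →
      ∃ x, ∀ i, (φ i).Realize (Sum.elim p fun _ => x)

variable (L) in
/-- A relation between two structures is partial elementary if related tuples satisfy the same
formulas. -/
def IsPartialElementary (R : Set (M × N)) : Prop :=
  ∀ ⦃n : ℕ⦄ (φ : L.Formula (Fin n)) (z : Fin n → M × N), (∀ i, z i ∈ R) →
    (φ.Realize (fun i => (z i).1) ↔ φ.Realize (fun i => (z i).2))

namespace IsPartialElementary

variable {R : Set (M × N)}

theorem swap (h : L.IsPartialElementary R) : L.IsPartialElementary (Prod.swap ⁻¹' R) :=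
  fun _ φ z hz => (h φ (fun i => (z i).swap) hz).symm

theorem empty (h : M ≅[L] N) : L.IsPartialElementary (∅ : Set (M × N)) := by
  intro n φ z hz
  obtain rfl : n = 0 := by
    by_contra hn
    exact hz ⟨0, Nat.pos_of_ne_zero hn⟩
  have key := h.realize_sentence (φ.relabel (Fin.elim0 : Fin 0 → Empty))
  simp only [Sentence.Realize, Formula.realize_relabel] at key
  convert! key using 2

theorem iUnion {ι : Type*} [Nonempty ι] {R : ι → Set (M × N)} (hR : Directed (· ⊆ ·) R)
    (h : ∀ i, L.IsPartialElementary (R i)) : L.IsPartialElementary (⋃ i, R i) := by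
  intro n φ z hz
  simp only [Set.mem_iUnion] at hz
  choose f hf using hz
  obtain ⟨j, hj⟩ := hR.finite_le f
  exact h j φ z fun i => hj i (hf i)

theorem realize_iff (h : L.IsPartialElementary R) (φ : L.Formula R) :
    φ.Realize (fun r => r.1.1) ↔ φ.Realize (fun r => r.1.2) := by
  classical
  have key := h (Formula.relabel (Fintype.equivFin φ.freeVarFinset) (φ.restrictFreeVar id))
    (fun i => ((Fintype.equivFin φ.freeVarFinset).symm i).1.1) (fun i => Subtype.prop _)
  rw [Formula.realize_relabel, Formula.realize_relabel] at key
  exact (BoundedFormula.realize_restrictFreeVar (fun r : R => r.1.1) (by simp)).symm.trans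
    (key.trans (BoundedFormula.realize_restrictFreeVar (fun r : R => r.1.2) (by simp)))

theorem exists_insert [Countable L.Symbols] (h : L.IsPartialElementary R) (hR : R.Countable)
    (hN : L.IsCountablySaturated N) (a : M) :
    ∃ b : N, L.IsPartialElementary (insert (a, b) R) := by
  classical
  have : Countable R := hR
  let T := {φ : L.Formula (R ⊕ Unit) // φ.Realize (Sum.elim (fun r => r.1.1) fun _ => a)}
  have : Nonempty T := ⟨⟨⊤, Formula.realize_top.2 trivial⟩⟩
  obtain ⟨φ, hφ⟩ := exists_surjective_nat T
  obtain ⟨b, hb⟩ := hN (fun r : R => r.1.2) (fun i => (φ i).1) (by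
    intro k
    have key := h.realize_iff ((Formula.iInf fun i : Fin k => (φ i).1).iExs Unit)
    simp only [Formula.realize_iExs, Formula.realize_iInf] at key
    obtain ⟨x, hx⟩ := key.1 ⟨fun _ => a, fun i => (φ i).2⟩
    exact ⟨x (), fun i hi => hx ⟨i, hi⟩⟩)
  have hT : ∀ ψ : L.Formula (R ⊕ Unit), ψ.Realize (Sum.elim (fun r => r.1.1) fun _ => a) →
      ψ.Realize (Sum.elim (fun r => r.1.2) fun _ => b) := by
    intro ψ hψ
    obtain ⟨i, hi⟩ := hφ ⟨ψ, hψ⟩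
    simpa [hi] using hb i
  have hT' : ∀ ψ : L.Formula (R ⊕ Unit), ψ.Realize (Sum.elim (fun r => r.1.1) fun _ => a) ↔
      ψ.Realize (Sum.elim (fun r => r.1.2) fun _ => b) := by
    refine fun ψ => ⟨hT ψ, fun hψ => ?_⟩
    by_contra hn
    exact Formula.realize_not.1 (hT ψ.not (Formula.realize_not.2 hn)) hψ
  refine ⟨b, fun n ψ z hz => ?_⟩
  let g : Fin n → R ⊕ Unit := fun i => if hi : z i ∈ R then .inl ⟨z i, hi⟩ else .inr ()
  have key := hT' (ψ.relabel g)
  rw [Formula.realize_relabel, Formula.realize_relabel] at key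
  convert! key using 2
  all_goals
    funext i
    by_cases hi : z i ∈ R
    · simp [g, hi]
    · have hgi : g i = .inr () := dif_neg hi
      simp [hgi, (hz i).resolve_right hi]

theorem exists_extension [Countable L.Symbols] (h : L.IsPartialElementary R) (hR : R.Countable)
    (hM : L.IsCountablySaturated M) (hN : L.IsCountablySaturated N) (a : M) (b : N) :
    ∃ S, R ⊆ S ∧ L.IsPartialElementary S ∧ S.Countable ∧ (∃ y, (a, y) ∈ S) ∧ ∃ x, (x, b) ∈ S := by
  obtain ⟨y, hy⟩ := h.exists_insert hR hN a
  have hc := hR.insert (a, y)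
  obtain ⟨x, hx⟩ := hy.swap.exists_insert (hc.preimage Prod.swap_injective) hM b
  have hS := hx.swap
  have hcS : (Prod.swap ⁻¹' insert (b, x) (Prod.swap ⁻¹' insert (a, y) R)).Countable :=
    ((hc.preimage Prod.swap_injective).insert (b, x)).preimage Prod.swap_injective
  exact ⟨_, fun r hr => .inr (.inr hr), hS, hcS, ⟨y, .inr (.inl rfl)⟩, ⟨x, .inl rfl⟩⟩

theorem nonempty_equiv (h : L.IsPartialElementary R) (hM : ∀ a, ∃ b, (a, b) ∈ R)
    (hN : ∀ b, ∃ a, (a, b) ∈ R) : Nonempty (M ≃[L] N) := by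
  choose f hf using hM
  let F : M ↪ₑ[L] N :=
    { toFun := f
      map_formula' := fun n φ x => (h φ (fun i => (x i, f (x i))) fun i => hf (x i)).symm }
  have hF : Function.Surjective F := by
    intro b
    obtain ⟨a, ha⟩ := hN b
    refine ⟨a, ?_⟩
    have key := h (Term.equal (Term.var 0) (Term.var 1) : L.Formula (Fin 2))
      ![(a, f a), (a, b)] (by simp [Fin.forall_fin_two, hf, ha])
    change f a = b
    simpa [Formula.realize_equal] using key
  exact ⟨{ Equiv.ofBijective F ⟨F.injective, hF⟩ with
    map_fun' := F.map_fun
    map_rel' := F.map_rel }⟩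

end IsPartialElementary

/-- Elementarily equivalent countably saturated structures of cardinality at most `ℵ₁` over a
countable language are isomorphic. -/
theorem IsCountablySaturated.nonempty_equiv [Countable L.Symbols]
    (hM : L.IsCountablySaturated M) (hN : L.IsCountablySaturated N) (h : M ≅[L] N)
    [Nonempty M] [Nonempty N] (cM : #M ≤ ℵ₁) (cN : #N ≤ ℵ₁) : Nonempty (M ≃[L] N) := by
  let I : Type w := (ℵ₁ : Cardinal.{w}).ord.ToType
  have hI : #I = ℵ₁ := mk_ord_toType _
  have hIio : ∀ i : I, Countable (Set.Iio i) := fun i => by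
    rw [← mk_le_aleph0_iff, ← Order.lt_succ_iff, succ_aleph0]
    exact (mk_Iio_lt i (by rw [hI, Ordinal.type_toType])).trans_eq hI
  obtain ⟨eM, surjM⟩ : ∃ e : I → M, Function.Surjective e := by
    obtain ⟨f⟩ := (hI ▸ cM : #M ≤ #I)
    exact ⟨_, Function.invFun_surjective f.injective⟩
  obtain ⟨eN, surjN⟩ : ∃ e : I → N, Function.Surjective e := by
    obtain ⟨f⟩ := (hI ▸ cN : #N ≤ #I)
    exact ⟨_, Function.invFun_surjective f.injective⟩
  have hext : ∀ (R : Set (M × N)) (a : M) (b : N), ∃ S, R ⊆ S ∧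
      (L.IsPartialElementary R → R.Countable → L.IsPartialElementary S ∧ S.Countable ∧
        (∃ y, (a, y) ∈ S) ∧ ∃ x, (x, b) ∈ S) := by
    intro R a b
    by_cases hR : L.IsPartialElementary R ∧ R.Countable
    · obtain ⟨S, hS, hS'⟩ := hR.1.exists_extension hR.2 hM hN a b
      exact ⟨S, hS, fun _ _ => hS'⟩
    · exact ⟨R, subset_rfl, fun h₁ h₂ => (hR ⟨h₁, h₂⟩).elim⟩
  choose ext hsub hext using hext
  let F : ∀ i : I, (∀ j : I, j < i → Set (M × N)) → Set (M × N) := fun i R =>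
    ext (⋃ j : Set.Iio i, R j.1 j.2) (eM i) (eN i)
  let R : I → Set (M × N) := wellFounded_lt.fix F
  have hR : ∀ i, R i = ext (⋃ j : Set.Iio i, R j) (eM i) (eN i) := fun i =>
    wellFounded_lt.fix_eq F i
  have hmono : Monotone R := by
    refine monotone_iff_forall_lt.2 fun j i hji => ?_
    rw [hR i]
    exact (Set.subset_iUnion (fun j : Set.Iio i => R j) ⟨j, hji⟩).trans (hsub _ _ _)
  have hunion : ∀ i, (∀ j < i, L.IsPartialElementary (R j) ∧ (R j).Countable) →
      L.IsPartialElementary (⋃ j : Set.Iio i, R j) ∧ (⋃ j : Set.Iio i, R j).Countable := by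
    intro i ih
    refine ⟨?_, Set.countable_iUnion fun j => (ih j j.2).2⟩
    rcases isEmpty_or_nonempty (Set.Iio i) with hi | hi
    · rw [Set.iUnion_of_empty]
      exact .empty h
    · exact .iUnion (hmono.comp (Subtype.mono_coe _)).directed_le fun j => (ih j j.2).1
  have hgood : ∀ i, L.IsPartialElementary (R i) ∧ (R i).Countable := by
    intro i
    induction i using WellFoundedLT.induction with
    | ind i ih =>
      obtain ⟨h₁, h₂⟩ := hunion i ih
      rw [hR i]
      exact ⟨(hext _ _ _ h₁ h₂).1, (hext _ _ _ h₁ h₂).2.1⟩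
  have hdom : ∀ i, (∃ y, (eM i, y) ∈ R i) ∧ ∃ x, (x, eN i) ∈ R i := by
    intro i
    obtain ⟨h₁, h₂⟩ := hunion i fun j _ => hgood j
    rw [hR i]
    exact (hext _ _ _ h₁ h₂).2.2
  have : Nonempty I := mk_ne_zero_iff.1 (hI ▸ (aleph_pos 1).ne')
  have htotal : L.IsPartialElementary (⋃ i, R i) :=
    .iUnion hmono.directed_le fun i => (hgood i).1
  refine htotal.nonempty_equiv (fun a => ?_) fun b => ?_
  · obtain ⟨i, rfl⟩ := surjM a
    exact (hdom i).1.imp fun y hy => Set.mem_iUnion_of_mem i hy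
  · obtain ⟨i, rfl⟩ := surjN b
    exact (hdom i).2.imp fun x hx => Set.mem_iUnion_of_mem i hx

/-- Ultraproducts over a free ultrafilter on `ℕ` are countably saturated. -/
theorem Ultraproduct.isCountablySaturated (M : ℕ → Type w) [∀ n, L.Structure (M n)]
    [∀ n, Nonempty (M n)] (𝒰 : Ultrafilter ℕ) (h𝒰 : (𝒰 : Filter ℕ) ≤ atTop) :
    L.IsCountablySaturated ((𝒰 : Filter ℕ).Product M) := by
  classical
  intro α p φ hφ
  choose q hq using fun a => Quotient.exists_rep (p a)
  obtain rfl : (fun a => (q a : (𝒰 : Filter ℕ).Product M)) = p := funext hq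
  have cast : ∀ (ψ : L.Formula (α ⊕ Unit)) (x : ∀ n, M n),
      ψ.Realize (Sum.elim (fun a => (q a : (𝒰 : Filter ℕ).Product M))
          fun _ => (x : (𝒰 : Filter ℕ).Product M)) ↔
        ∀ᶠ n in (𝒰 : Filter ℕ), ψ.Realize (Sum.elim (fun a => q a n) fun _ => x n) := by
    intro ψ x
    have key := realize_formula_cast (u := 𝒰) ψ (Sum.elim q fun _ => x)
    convert! key using 2
    · funext i
      cases i <;> rfl
    · congr! 2
      funext i
      cases i <;> rfl
  let P : ℕ → ℕ → Prop := fun n k =>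
    ∃ x : M n, ∀ i < k, (φ i).Realize (Sum.elim (fun a => q a n) fun _ => x)
  have hP₀ : ∀ n, P n 0 := fun n => ⟨Classical.arbitrary _, by simp⟩
  have hP : ∀ k, ∀ᶠ n in (𝒰 : Filter ℕ), P n k := by
    intro k
    obtain ⟨x, hx⟩ := hφ k
    obtain ⟨x, rfl⟩ := Quotient.exists_rep x
    have : ∀ᶠ n in (𝒰 : Filter ℕ), ∀ i ∈ Set.Iio k,
        (φ i).Realize (Sum.elim (fun a => q a n) fun _ => x n) :=
      (eventually_all_finite (Set.finite_Iio k)).2 fun i hi => (cast (φ i) _).1 (hx i hi)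
    exact this.mono fun n hn => ⟨x n, hn⟩
  have hmax : ∀ n, P n (Nat.findGreatest (P n) n) := fun n =>
    Nat.findGreatest_spec (Nat.zero_le n) (hP₀ n)
  choose x hx using hmax
  refine ⟨(x : (𝒰 : Filter ℕ).Product M), fun i => (cast (φ i) x).2 ?_⟩
  filter_upwards [hP (i + 1), h𝒰 (eventually_ge_atTop (i + 1))] with n hn hin
  exact hx n i (Nat.le_findGreatest hin hn)

end FirstOrder.Language

/-- Germs of functions are elements of the corresponding constant filter product. -/
def Filter.Germ.equivProduct {α β : Type*} (l : Filter α) :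
    l.Germ β ≃ l.Product fun _ => β :=
  Quotient.congr (Equiv.refl _) fun _ _ => Iff.rfl

theorem Filter.Germ.equivProduct_add {α R : Type*} [Ring R] [Ring.CompatibleRing R]
    {𝒰 : Ultrafilter α} (x y : Germ (𝒰 : Filter α) R) :
    equivProduct _ (x + y) = Language.Structure.funMap (L := Language.ring) Ring.addFunc
      ![equivProduct _ x, equivProduct _ y] := by
  induction x, y using Filter.Germ.inductionOn₂ with | h f g =>
  have key := Language.Ultraproduct.funMap_cast (u := 𝒰) (L := Language.ring)
    (M := fun _ => R) Ring.addFunc ![f, g]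
  simp only [Ring.CompatibleRing.funMap_add] at key
  refine Eq.trans ?_ (key.symm.trans (congrArg _ ?_))
  · rfl
  · funext i
    fin_cases i <;> rfl

theorem Filter.Germ.equivProduct_mul {α R : Type*} [Ring R] [Ring.CompatibleRing R]
    {𝒰 : Ultrafilter α} (x y : Germ (𝒰 : Filter α) R) :
    equivProduct _ (x * y) = Language.Structure.funMap (L := Language.ring) Ring.mulFunc
      ![equivProduct _ x, equivProduct _ y] := by
  induction x, y using Filter.Germ.inductionOn₂ with | h f g =>
  have key := Language.Ultraproduct.funMap_cast (u := 𝒰) (L := Language.ring)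
    (M := fun _ => R) Ring.mulFunc ![f, g]
  simp only [Ring.CompatibleRing.funMap_mul] at key
  refine Eq.trans ?_ (key.symm.trans (congrArg _ ?_))
  · rfl
  · funext i
    fin_cases i <;> rfl

/-- Nonnegative real germs are squares. -/
theorem Filter.Germ.nonneg_iff_exists_sq {α : Type*} (l : Filter α) (x : l.Germ ℝ) :
    0 ≤ x ↔ ∃ y, x = y * y := by
  constructor
  · induction x using Filter.Germ.inductionOn with | h f =>
    intro hf
    have hf' : ∀ᶠ n in l, 0 ≤ f n := Germ.coe_le.1 hf
    exact ⟨((fun n => √(f n) : α → ℝ) : l.Germ ℝ),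
      Germ.coe_eq.2 (hf'.mono fun n hn => (Real.mul_self_sqrt hn).symm)⟩
  · rintro ⟨y, rfl⟩
    induction y using Filter.Germ.inductionOn with | h f =>
    exact Germ.coe_le.2 (Eventually.of_forall fun n => mul_self_nonneg (f n))

/-- Ring isomorphisms of fields of real germs preserve the order. -/
theorem Filter.Germ.map_le_map_iff_of_ringEquiv {α : Type*} {𝒰 𝒱 : Ultrafilter α}
    (e : Germ (𝒰 : Filter α) ℝ ≃+* Germ (𝒱 : Filter α) ℝ) {a b : Germ (𝒰 : Filter α) ℝ} :
    e a ≤ e b ↔ a ≤ b := by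
  rw [← sub_nonneg, ← sub_nonneg (a := b), ← map_sub, nonneg_iff_exists_sq, nonneg_iff_exists_sq]
  constructor
  · rintro ⟨y, hy⟩
    exact ⟨e.symm y, e.injective (by simp [hy])⟩
  · rintro ⟨y, hy⟩
    exact ⟨e y, by rw [hy, map_mul]⟩

/-- Assuming the continuum hypothesis, the ultrapowers `ℝ^ℕ/𝒰₁` and `ℝ^ℕ/𝒰₂` with respect
to any two free ultrafilters on `ℕ` are isomorphic as ordered fields. -/
theorem ultrapowers_isomorphic_of_CH
    (ch : Cardinal.continuum = Cardinal.aleph 1)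
    (𝒰₁ 𝒰₂ : Ultrafilter ℕ)
    (h₁ : ∀ s : Set ℕ, s ∈ 𝒰₁ → s.Infinite)
    (h₂ : ∀ s : Set ℕ, s ∈ 𝒰₂ → s.Infinite) :
    Nonempty (Filter.Germ (𝒰₁ : Filter ℕ) ℝ ≃+*o Filter.Germ (𝒰₂ : Filter ℕ) ℝ) := by
  let := Ring.compatibleRingOfRing ℝ
  have hfree : ∀ 𝒰 : Ultrafilter ℕ, (∀ s : Set ℕ, s ∈ 𝒰 → s.Infinite) →
      (𝒰 : Filter ℕ) ≤ atTop := by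
    intro 𝒰 h
    rw [← Nat.cofinite_eq_atTop]
    refine fun s hs => by_contra fun hn => ?_
    exact h sᶜ (Ultrafilter.compl_mem_iff_notMem.2 hn) hs
  have ch₀ : (𝔠 : Cardinal.{0}) = ℵ₁ := by
    apply lift_injective
    rw [lift_continuum, lift_aleph, ch, Ordinal.lift_one]
  have hcard : ∀ 𝒰 : Ultrafilter ℕ, #((𝒰 : Filter ℕ).Product fun _ => ℝ) ≤ ℵ₁ := by
    intro 𝒰
    refine (mk_le_of_surjective Quotient.mk_surjective).trans ?_
    simp [mk_real, ch₀.symm]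
  have : Countable Language.ring.Symbols := by
    rw [← mk_le_aleph0_iff]
    exact Ring.card_ring.le.trans (natCast_lt_aleph0 (n := 5)).le
  have hequiv : ((𝒰₁ : Filter ℕ).Product fun _ => ℝ) ≅[Language.ring]
      ((𝒰₂ : Filter ℕ).Product fun _ => ℝ) := by
    rw [Language.elementarilyEquivalent_iff]
    intro φ
    simp [Language.Ultraproduct.sentence_realize]
  obtain ⟨e⟩ := Language.IsCountablySaturated.nonempty_equiv
    (Language.Ultraproduct.isCountablySaturated (L := Language.ring) (fun _ => ℝ) 𝒰₁ (hfree _ h₁))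
    (Language.Ultraproduct.isCountablySaturated (fun _ => ℝ) 𝒰₂ (hfree _ h₂))
    hequiv (hcard _) (hcard _)
  let φ₁ := Germ.equivProduct (β := ℝ) (𝒰₁ : Filter ℕ)
  let φ₂ := Germ.equivProduct (β := ℝ) (𝒰₂ : Filter ℕ)
  let E := (φ₁.trans e.toEquiv).trans φ₂.symm
  have hE : ∀ x, φ₂ (E x) = e (φ₁ x) := fun x => φ₂.apply_symm_apply _
  let f : Germ (𝒰₁ : Filter ℕ) ℝ ≃+* Germ (𝒰₂ : Filter ℕ) ℝ :=
    { E with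
      map_add' := fun x y => φ₂.injective <| by
        refine (hE _).trans ((congrArg e (Germ.equivProduct_add x y)).trans
          ((e.map_fun _ _).trans (Eq.trans ?_ (Germ.equivProduct_add (E x) (E y)).symm)))
        congr 1
        funext i
        fin_cases i
        · exact (hE x).symm
        · exact (hE y).symm
      map_mul' := fun x y => φ₂.injective <| by
        refine (hE _).trans ((congrArg e (Germ.equivProduct_mul x y)).trans
          ((e.map_fun _ _).trans (Eq.trans ?_ (Germ.equivProduct_mul (E x) (E y)).symm)))
        congr 1
        funext i
        fin_cases i
        · exact (hE x).symm
        · exact (hE y).symm }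
  exact ⟨{ f with map_le_map_iff' := Germ.map_le_map_iff_of_ringEquiv f }⟩
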